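/- Let z₁,…,z_n ∈ ℂ^× be pairwise distinct, let C = (z₁,…,z_n) ∈ T^reg (so e^{ε_i−ε_j}(C) = z_i/z_j), and set χ = (χ₀, χ₁,…,χ_n) := (0, z₁,…,z_n). Then ψ(Q(C)) = G(χ), where G(χ) ⊆ t_A(n+1) is the span of the rational Gaudin Hamiltonians H_i(χ) := Σ_{0≤j≤n, j≠i} t_{ij}/(χ_i − χ_j) for i = 0,1,…,n, and ψ is the homomorphism determined by ψ(t_{ij}) = t_{ij} for 1 ≤ i < j ≤ n and ψ(τ(ω_k)) = −Σ_{l=1}^{k} Σ_{c=0}^{l−1} t_{cl} for k = 1,…,n. -/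

import Mathlib

open FreeLieAlgebra

noncomputable section

/-- The free Lie algebra on generators `t_{ij}`, `i, j ∈ {0, …, N-1}`. -/
abbrev FA (N : ℕ) := FreeLieAlgebra ℂ (Fin N × Fin N)

/-- The defining relations of the type-A holonomy Lie algebra `t_A(N)` on the index set
`{0, 1, …, N-1}`: symmetry `t_{ij} = t_{ji}` (with `t_{ii} = 0`, so that the actual
generators are `t_{ij}` for `i < j`), `[t_{ij}, t_{ik} + t_{jk}] = 0` for pairwise distinct
`i, j, k`, and `[t_{ij}, t_{kl}] = 0` for `{i,j} ∩ {k,l} = ∅`. -/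
def tARel (N : ℕ) : Set (FA N) :=
  {x | (∃ i j : Fin N, x = FreeLieAlgebra.of ℂ ((i, j) : Fin N × Fin N) -
          FreeLieAlgebra.of ℂ ((j, i) : Fin N × Fin N)) ∨
    (∃ i : Fin N, x = FreeLieAlgebra.of ℂ ((i, i) : Fin N × Fin N)) ∨
    (∃ i j k : Fin N, i ≠ j ∧ i ≠ k ∧ j ≠ k ∧
      x = ⁅FreeLieAlgebra.of ℂ ((i, j) : Fin N × Fin N),
           FreeLieAlgebra.of ℂ ((i, k) : Fin N × Fin N) +
           FreeLieAlgebra.of ℂ ((j, k) : Fin N × Fin N)⁆) ∨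
    (∃ i j k l : Fin N, i ≠ k ∧ i ≠ l ∧ j ≠ k ∧ j ≠ l ∧
      x = ⁅FreeLieAlgebra.of ℂ ((i, j) : Fin N × Fin N),
           FreeLieAlgebra.of ℂ ((k, l) : Fin N × Fin N)⁆)}

/-- The Lie ideal generated by the relations of `t_A(N)`. -/
def tAIdeal (N : ℕ) : LieIdeal ℂ (FA N) := LieSubmodule.lieSpan ℂ (FA N) (tARel N)

/-- The type-A holonomy Lie algebra `t_A(N)` (the holonomy Lie algebra of the root system
`A_{N-1}`), on the index set `{0, 1, …, N-1}`. -/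
abbrev tA (N : ℕ) := FA N ⧸ tAIdeal N

/-- The image of the generator `t_{ij}` in `t_A(N)`. -/
def tgenA (N : ℕ) (i j : Fin N) : tA N :=
  LieSubmodule.Quotient.mk' (tAIdeal N) (FreeLieAlgebra.of ℂ ((i, j) : Fin N × Fin N))

/-- `h = ℂⁿ`. -/
abbrev VA (n : ℕ) := Fin n → ℂ

/-- The coordinate functional `ε_i ∈ (ℂⁿ)*`. -/
def eps (n : ℕ) (i : Fin n) : Module.Dual ℂ (VA n) := LinearMap.proj i

/-- The type `A_{n-1}` root system `Φ = {ε_i - ε_j : i ≠ j} ⊆ (ℂⁿ)*` (gl_n realization). -/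
def PhiA (n : ℕ) : Set (Module.Dual ℂ (VA n)) :=
  {f | ∃ i j : Fin n, i ≠ j ∧ f = eps n i - eps n j}

/-- The positive roots `ε_i - ε_j`, `i < j`. -/
def PhiAplus (n : ℕ) : Set (Module.Dual ℂ (VA n)) :=
  {f | ∃ i j : Fin n, i < j ∧ f = eps n i - eps n j}

/-- The free Lie algebra on the generators `t_α` (`α ∈ Φ`) and `τ(h)` (`h ∈ ℂⁿ`). -/
abbrev FTrigA (n : ℕ) := FreeLieAlgebra ℂ (↥(PhiA n) ⊕ VA n)

open Classical in
/-- The generator `t_α` in the free Lie algebra (junk value `0` for `α ∉ Φ`). -/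
def tgA (n : ℕ) (f : Module.Dual ℂ (VA n)) : FTrigA n :=
  if h : f ∈ PhiA n then FreeLieAlgebra.of ℂ (Sum.inl (⟨f, h⟩ : ↥(PhiA n))) else 0

/-- The generator `τ(h)`. -/
def ttA (n : ℕ) (v : VA n) : FTrigA n := FreeLieAlgebra.of ℂ (Sum.inr v)

/-- `δ(h) = τ(h) - (1/2) ∑_{β ∈ Φ⁺} β(h) t_β`. -/
def tdA (n : ℕ) (v : VA n) : FTrigA n :=
  ttA n v - (2⁻¹ : ℂ) • ∑ᶠ f ∈ PhiAplus n, f v • tgA n f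

/-- The defining relations of the trigonometric holonomy Lie algebra `t_n^trig` of type
`A_{n-1}`: `t_{-α} = t_α`; `τ` is `ℂ`-linear; `[τ(h₁), τ(h₂)] = 0`;
`[t_α, ∑_{β ∈ Ψ⁺} t_β] = 0` for every closed rank-2 root subsystem `Ψ ⊆ Φ` and `α ∈ Ψ`; and
`[t_α, δ(h)] = 0` whenever `α(h) = 0`. -/
def trigARel (n : ℕ) : Set (FTrigA n) :=
  {x | (∃ α ∈ PhiA n, x = tgA n α - tgA n (-α)) ∨
    (∃ (c₁ c₂ : ℂ) (h₁ h₂ : VA n),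
      x = ttA n (c₁ • h₁ + c₂ • h₂) - c₁ • ttA n h₁ - c₂ • ttA n h₂) ∨
    (∃ h₁ h₂ : VA n, x = ⁅ttA n h₁, ttA n h₂⁆) ∨
    (∃ Ψ : Set (Module.Dual ℂ (VA n)), Ψ ⊆ PhiA n ∧ (∀ α ∈ Ψ, -α ∈ Ψ) ∧
      Module.finrank ℂ (Submodule.span ℂ Ψ) = 2 ∧
      (∀ α ∈ Ψ, ∀ β ∈ Ψ, α + β ∈ PhiA n → α + β ∈ Ψ) ∧
      ∃ α ∈ Ψ, x = ⁅tgA n α, ∑ᶠ β ∈ Ψ ∩ PhiAplus n, tgA n β⁆) ∨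
    (∃ α ∈ PhiA n, ∃ v : VA n, α v = 0 ∧ x = ⁅tgA n α, tdA n v⁆)}

/-- The Lie ideal generated by the trigonometric relations. -/
def trigAIdeal (n : ℕ) : LieIdeal ℂ (FTrigA n) :=
  LieSubmodule.lieSpan ℂ (FTrigA n) (trigARel n)

/-- The trigonometric holonomy Lie algebra `t_n^trig` of type `A_{n-1}`. -/
abbrev TrigA (n : ℕ) := FTrigA n ⧸ trigAIdeal n

/-- The image of `t_{ij} = t_{ε_i - ε_j}` in `t_n^trig`. -/
def TijA (n : ℕ) (i j : Fin n) : TrigA n :=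
  LieSubmodule.Quotient.mk' (trigAIdeal n) (tgA n (eps n i - eps n j))

/-- The image of `τ(h)` in `t_n^trig`. -/
def TauA (n : ℕ) (v : VA n) : TrigA n :=
  LieSubmodule.Quotient.mk' (trigAIdeal n) (ttA n v)

/-- `ω_k = e₁ + ⋯ + e_k ∈ ℂⁿ`. -/
def omegaA (n k : ℕ) : VA n := fun i => if (i : ℕ) < k then 1 else 0

/-- The element `∑_{l=1}^{k} ∑_{c=0}^{l-1} t_{cl} ∈ t_A(n+1)` (a partial sum of
Jucys–Murphy elements). -/
def JMsum (n k : ℕ) : tA (n + 1) :=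
  ∑ p ∈ Finset.univ.filter
      (fun p : Fin (n + 1) × Fin (n + 1) => p.1 < p.2 ∧ (p.2 : ℕ) ≤ k),
    tgenA (n + 1) p.1 p.2

/-- The Bethe Hamiltonian `BH(C,h) = τ(h) - ∑_{α ∈ Φ⁺} (e^α(C) α(h)/(e^α(C) - 1)) t_α` for
`C = (z₁, …, z_n) ∈ (ℂ^×)ⁿ`, where `e^{ε_i - ε_j}(C) = z_i/z_j`. -/
def BHA (n : ℕ) (z : Fin n → ℂ) (v : VA n) : TrigA n :=
  TauA n v - ∑ p ∈ Finset.univ.filter (fun p : Fin n × Fin n => p.1 < p.2),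
    ((z p.1 / z p.2) * (v p.1 - v p.2) / (z p.1 / z p.2 - 1)) • TijA n p.1 p.2

/-- The Bethe subspace `Q(C) = span{BH(C,h) : h ∈ ℂⁿ} ⊆ t_n^trig`. -/
def QA (n : ℕ) (z : Fin n → ℂ) : Submodule ℂ (TrigA n) :=
  Submodule.span ℂ (Set.range (BHA n z))

/-- `χ = (0, z₁, …, z_n) ∈ ℂ^{n+1}`. -/
def chiA (n : ℕ) (z : Fin n → ℂ) : Fin (n + 1) → ℂ := Fin.cases 0 z

/-- The rational Gaudin Hamiltonian `H_i(χ) = ∑_{j ≠ i} t_{ij}/(χ_i - χ_j) ∈ t_A(n+1)`. -/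
def HamA (n : ℕ) (z : Fin n → ℂ) (i : Fin (n + 1)) : tA (n + 1) :=
  ∑ j ∈ Finset.univ.filter (fun j : Fin (n + 1) => j ≠ i),
    (chiA n z i - chiA n z j)⁻¹ • tgenA (n + 1) i j

/-- The Gaudin subspace `G(χ) = span{H_i(χ) : i = 0, 1, …, n} ⊆ t_A(n+1)`. -/
def GA (n : ℕ) (z : Fin n → ℂ) : Submodule ℂ (tA (n + 1)) :=
  Submodule.span ℂ (Set.range (HamA n z))

theorem tgenA_comm (N : ℕ) (i j : Fin N) : tgenA N i j = tgenA N j i := by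
  rw [← sub_eq_zero]
  exact (LieSubmodule.Quotient.mk_eq_zero').2
    (LieSubmodule.subset_lieSpan (Or.inl ⟨i, j, rfl⟩))

theorem TauA_smul_add_smul (n : ℕ) (c₁ c₂ : ℂ) (h₁ h₂ : VA n) :
    TauA n (c₁ • h₁ + c₂ • h₂) = c₁ • TauA n h₁ + c₂ • TauA n h₂ := by
  rw [← sub_eq_zero, ← sub_sub]
  exact (LieSubmodule.Quotient.mk_eq_zero').2
    (LieSubmodule.subset_lieSpan (Or.inr (Or.inl ⟨c₁, c₂, h₁, h₂, rfl⟩)))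

/-- The map `τ : ℂⁿ → t_n^trig` as a linear map. -/
def TauALin (n : ℕ) : VA n →ₗ[ℂ] TrigA n where
  toFun := TauA n
  map_add' a b := by simpa using TauA_smul_add_smul n 1 1 a b
  map_smul' c a := by simpa using TauA_smul_add_smul n c 0 a 0

/-- The Bethe Hamiltonian `h ↦ BH(C,h)` as a linear map. -/
def BHALin (n : ℕ) (z : Fin n → ℂ) : VA n →ₗ[ℂ] TrigA n :=
  TauALin n - ∑ p ∈ Finset.univ.filter (fun p : Fin n × Fin n => p.1 < p.2),
    LinearMap.smulRight ((z p.1 / z p.2 / (z p.1 / z p.2 - 1)) • (eps n p.1 - eps n p.2))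
      (TijA n p.1 p.2)

theorem BHALin_apply (n : ℕ) (z : Fin n → ℂ) (v : VA n) : BHALin n z v = BHA n z v := by
  simp only [BHALin, BHA, LinearMap.sub_apply, LinearMap.sum_apply, LinearMap.smulRight_apply,
    LinearMap.smul_apply, eps, LinearMap.proj_apply, smul_eq_mul]
  congr 1
  refine Finset.sum_congr rfl fun p _ => ?_
  rw [div_mul_eq_mul_div]

theorem range_BHALin (n : ℕ) (z : Fin n → ℂ) : LinearMap.range (BHALin n z) = QA n z := by
  rw [QA, ← funext (BHALin_apply n z), ← LinearMap.coe_range, Submodule.span_eq]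

theorem omegaA_succ_sub (n : ℕ) (k : Fin n) :
    omegaA n (k + 1) - omegaA n k = Pi.single k 1 := by
  funext i
  rcases lt_trichotomy i k with h | rfl | h
  · have : (i : ℕ) < k := h
    simp [omegaA, h.ne, this, this.trans (Nat.lt_succ_self _)]
  · simp [omegaA]
  · have : (k : ℕ) < i := h
    simp [omegaA, h.ne', this.not_gt, Nat.not_lt.2 (Nat.succ_le_of_lt this)]

theorem JMsum_eq_sum_ite (n k : ℕ) :
    JMsum n k = ∑ l : Fin (n + 1), if (l : ℕ) ≤ k then
      ∑ c : Fin (n + 1), (if c < l then tgenA (n + 1) c l else 0) else 0 := by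
  rw [JMsum, Finset.sum_filter, Fintype.sum_prod_type_right]
  refine Finset.sum_congr rfl fun l _ => ?_
  split_ifs with h <;> simp [h]

theorem JMsum_succ_sub (n : ℕ) (k : Fin n) :
    JMsum n (k + 1) - JMsum n k =
      ∑ c : Fin (n + 1), if c < k.succ then tgenA (n + 1) c k.succ else 0 := by
  rw [JMsum_eq_sum_ite, JMsum_eq_sum_ite, ← Finset.sum_sub_distrib,
    Finset.sum_eq_single k.succ]
  · simp
  · intro l _ hl
    have hl' : (l : ℕ) ≠ k + 1 := fun h => hl (Fin.ext (by simpa using h))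
    by_cases h : (l : ℕ) ≤ k
    · simp [h, Nat.le_succ_of_le h]
    · simp [h, show ¬ (l : ℕ) ≤ k + 1 by omega]
  · simp

theorem JMsum_zero (n : ℕ) : JMsum n 0 = 0 := by
  rw [JMsum_eq_sum_ite]
  refine Finset.sum_eq_zero fun l _ => ?_
  split_ifs with h
  · have : l = 0 := Fin.ext (by simpa using h)
    simp [this]
  · rfl

theorem sum_lt_smul_single_sub {n : ℕ} {M : Type*} [AddCommGroup M] [Module ℂ M]
    (a : Fin n → Fin n → ℂ) (t : Fin n → Fin n → M) (k : Fin n) :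
    ∑ p ∈ Finset.univ.filter (fun p : Fin n × Fin n => p.1 < p.2),
      (a p.1 p.2 * ((Pi.single k 1 : Fin n → ℂ) p.1 - (Pi.single k 1 : Fin n → ℂ) p.2)) •
        t p.1 p.2 =
    ∑ j, ((if k < j then a k j • t k j else 0) - if j < k then a j k • t j k else 0) := by
  have h : ∀ p : Fin n × Fin n, (if p.1 < p.2 then
      (a p.1 p.2 * ((Pi.single k 1 : Fin n → ℂ) p.1 - (Pi.single k 1 : Fin n → ℂ) p.2)) •
        t p.1 p.2 else 0) =
      (if p.1 = k then (if p.1 < p.2 then a p.1 p.2 • t p.1 p.2 else 0) else 0) -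
      (if p.2 = k then (if p.1 < p.2 then a p.1 p.2 • t p.1 p.2 else 0) else 0) := by
    intro p
    simp only [Pi.single_apply]
    split_ifs <;> simp
  rw [Finset.sum_filter, Finset.sum_congr rfl fun p _ => h p, Finset.sum_sub_distrib,
    Finset.sum_sub_distrib]
  congr 1
  · rw [Fintype.sum_prod_type_right]
    simp
  · rw [Fintype.sum_prod_type]
    simp

theorem HamA_eq_sum (n : ℕ) (z : Fin n → ℂ) (i : Fin (n + 1)) :
    HamA n z i = ∑ j, (chiA n z i - chiA n z j)⁻¹ • tgenA (n + 1) i j := by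
  rw [HamA]
  refine Finset.sum_subset (Finset.subset_univ _) fun j _ hj => ?_
  obtain rfl : j = i := by simpa using hj
  simp

theorem sum_HamA (n : ℕ) (z : Fin n → ℂ) : ∑ i, HamA n z i = 0 := by
  have h : ∑ i, HamA n z i = -∑ i, HamA n z i := by
    simp only [HamA_eq_sum]
    conv_lhs => rw [Finset.sum_comm]
    simp only [← Finset.sum_neg_distrib]
    refine Finset.sum_congr rfl fun i _ => Finset.sum_congr rfl fun j _ => ?_
    rw [tgenA_comm, ← neg_smul, ← inv_neg, neg_sub]
  have h2 : (2 : ℂ) • ∑ i, HamA n z i = 0 := by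
    rw [two_smul]
    exact eq_neg_iff_add_eq_zero.1 h
  exact (smul_eq_zero_iff_right two_ne_zero).1 h2

theorem map_TauA_single (n : ℕ) (ψ : TrigA n →ₗ⁅ℂ⁆ tA (n + 1))
    (hψτ : ∀ k : ℕ, 1 ≤ k → k ≤ n → ψ (TauA n (omegaA n k)) = -JMsum n k) (k : Fin n) :
    ψ (TauA n (Pi.single k 1)) =
      -∑ c : Fin (n + 1), if c < k.succ then tgenA (n + 1) c k.succ else 0 := by
  have h : ∀ m ≤ n, ψ (TauA n (omegaA n m)) = -JMsum n m := by
    intro m hm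
    rcases Nat.eq_zero_or_pos m with rfl | h0
    · have : omegaA n 0 = 0 := by funext i; simp [omegaA]
      rw [this, JMsum_zero, show TauA n 0 = 0 from (TauALin n).map_zero, map_zero, neg_zero]
    · exact hψτ m h0 hm
  rw [← omegaA_succ_sub, show TauA n (omegaA n (k + 1) - omegaA n k) = _ from
    (TauALin n).map_sub _ _, map_sub, ← JMsum_succ_sub]
  change ψ (TauA n _) - ψ (TauA n _) = _
  rw [h _ k.2, h _ k.2.le]
  abel

theorem map_BHA_single (n : ℕ) (z : Fin n → ℂ)
    (hz : ∀ i, z i ≠ 0) (hdist : ∀ i j : Fin n, i ≠ j → z i ≠ z j)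
    (ψ : TrigA n →ₗ⁅ℂ⁆ tA (n + 1))
    (hψt : ∀ i j : Fin n, i < j → ψ (TijA n i j) = tgenA (n + 1) i.succ j.succ)
    (hψτ : ∀ k : ℕ, 1 ≤ k → k ≤ n → ψ (TauA n (omegaA n k)) = -JMsum n k) (k : Fin n) :
    ψ (BHA n z (Pi.single k 1)) = -z k • HamA n z k.succ := by
  have hcoef : ∀ i j : Fin n, i ≠ j →
      z i / z j / (z i / z j - 1) = z i * (z i - z j)⁻¹ := by
    intro i j hij
    have h1 := hz j
    have h2 : z i - z j ≠ 0 := sub_ne_zero.2 (hdist i j hij)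
    rw [div_sub_one h1, div_div_div_cancel_right₀ h1, div_eq_mul_inv]
  have hsum : ψ (∑ p ∈ Finset.univ.filter (fun p : Fin n × Fin n => p.1 < p.2),
      ((z p.1 / z p.2) * ((Pi.single k 1 : Fin n → ℂ) p.1 - (Pi.single k 1 : Fin n → ℂ) p.2) /
        (z p.1 / z p.2 - 1)) • TijA n p.1 p.2) =
      ∑ j, ((if k < j then (z k * (z k - z j)⁻¹) • tgenA (n + 1) k.succ j.succ else 0) -
        if j < k then (z j * (z j - z k)⁻¹) • tgenA (n + 1) j.succ k.succ else 0) := by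
    rw [← sum_lt_smul_single_sub (fun i j => z i * (z i - z j)⁻¹)
      (fun i j => tgenA (n + 1) i.succ j.succ), map_sum]
    refine Finset.sum_congr rfl fun p hp => ?_
    have hp' : p.1 < p.2 := by simpa using hp
    rw [map_smul, hψt _ _ hp', ← hcoef _ _ hp'.ne, mul_div_right_comm]
  rw [BHA, map_sub, map_TauA_single n ψ hψτ, hsum, HamA_eq_sum, Fin.sum_univ_succ,
    Fin.sum_univ_succ, neg_add, smul_add, add_sub_assoc]
  congr 1
  · simp [chiA, tgenA_comm _ 0, smul_smul, hz k]
  · rw [← Finset.sum_neg_distrib, ← Finset.sum_sub_distrib, Finset.smul_sum]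
    refine Finset.sum_congr rfl fun j _ => ?_
    simp only [chiA, Fin.cases_succ, Fin.succ_lt_succ_iff]
    rcases lt_trichotomy j k with h | rfl | h
    · have h2 : z j - z k ≠ 0 := sub_ne_zero.2 (hdist j k h.ne)
      have h3 : z k - z j ≠ 0 := sub_ne_zero.2 (hdist k j h.ne')
      simp only [h, h.not_gt, if_true, if_false, zero_sub, sub_neg_eq_add]
      rw [tgenA_comm _ k.succ, smul_smul, ← neg_one_smul ℂ, ← add_smul]
      congr 1
      rw [← neg_sub (z j) (z k)]
      field_simp
      ring
    · simp
    · simp only [h, h.not_gt, if_true, if_false, sub_zero, neg_zero, zero_sub]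
      rw [smul_smul, ← neg_smul, neg_mul]

/-- Let `z₁, …, z_n ∈ ℂ^×` be pairwise distinct, `C = (z₁, …, z_n) ∈ T^reg`, and
`χ = (0, z₁, …, z_n)`. Then `ψ(Q(C)) = G(χ)`, where `ψ : t_n^trig → t_A(n+1)` is the
homomorphism determined by `ψ(t_{ij}) = t_{ij}` and
`ψ(τ(ω_k)) = -∑_{l=1}^{k} ∑_{c=0}^{l-1} t_{cl}`. -/
theorem psi_maps_bethe_to_gaudin (n : ℕ) (z : Fin n → ℂ)
    (hz : ∀ i, z i ≠ 0) (hdist : ∀ i j : Fin n, i ≠ j → z i ≠ z j)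
    (ψ : TrigA n →ₗ⁅ℂ⁆ tA (n + 1))
    (hψt : ∀ i j : Fin n, i < j → ψ (TijA n i j) = tgenA (n + 1) i.succ j.succ)
    (hψτ : ∀ k : ℕ, 1 ≤ k → k ≤ n → ψ (TauA n (omegaA n k)) = -JMsum n k) :
    Submodule.map ψ.toLinearMap (QA n z) = GA n z := by
  have hmap : Submodule.map ψ.toLinearMap (QA n z) =
      Submodule.span ℂ (Set.range fun k : Fin n => -z k • HamA n z k.succ) := by
    rw [← range_BHALin, ← LinearMap.range_comp, LinearMap.range_eq_map,
      ← (Pi.basisFun ℂ (Fin n)).span_eq, Submodule.map_span, ← Set.range_comp]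
    congr 2
    funext k
    simp only [Function.comp_apply, Pi.basisFun_apply, LinearMap.comp_apply, BHALin_apply]
    exact map_BHA_single n z hz hdist ψ hψt hψτ k
  rw [hmap]
  apply le_antisymm
  · rw [Submodule.span_le]
    rintro _ ⟨k, rfl⟩
    exact Submodule.smul_mem _ _ (Submodule.subset_span ⟨k.succ, rfl⟩)
  · have hsucc : ∀ k : Fin n, HamA n z k.succ ∈
        Submodule.span ℂ (Set.range fun k : Fin n => -z k • HamA n z k.succ) := fun k =>
      (Submodule.smul_mem_iff _ (neg_ne_zero.2 (hz k))).1 (Submodule.subset_span ⟨k, rfl⟩)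
    rw [GA, Submodule.span_le]
    rintro _ ⟨i, rfl⟩
    refine Fin.cases ?_ hsucc i
    have h0 := sum_HamA n z
    rw [Fin.sum_univ_succ] at h0
    rw [eq_neg_of_add_eq_zero_left h0]
    exact Submodule.neg_mem _ (Submodule.sum_mem _ fun k _ => hsucc k)

end
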